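/- (Grabowski–Rotkiewicz theorem, single-fiber case.) Let V be a finite-dimensional real normed vector space and h : ℝ → V → V a smooth action of the multiplicative monoid (ℝ,·) on V (h 1 = id, h (λ*μ) = (h λ) ∘ (h μ), and (λ,x) ↦ h λ x smooth) such that h 0 x = 0 for all x ∈ V. If the action is regular, i.e. deriv (fun λ => h λ x) 0 = 0 implies x = 0, then the vertical lift V_h : V → V defined by V_h(x) := deriv (fun λ => h λ x) 0 is a bijection and intertwines h with scalar multiplication: V_h(h λ x) = λ • V_h(x) for all λ ∈ ℝ and x ∈ V. In particular, transporting the linear structure along V_h gives a vector space structure on V for which h is the scalar multiplication. -/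

import Mathlib

/-- (Grabowski–Rotkiewicz, single-fiber case.) Let `h` be a smooth action of the
multiplicative monoid `(ℝ, ·)` on a finite-dimensional real normed space `V` with
`h 0 x = 0` for all `x`. If the action is regular, then the vertical lift
`V_h(x) := deriv (fun λ => h λ x) 0` is a bijection of `V` and intertwines `h`
with scalar multiplication: `V_h (h λ x) = λ • V_h x`. -/
theorem grabowski_rotkiewicz_single_fiber
    {V : Type*} [NormedAddCommGroup V] [NormedSpace ℝ V] [FiniteDimensional ℝ V]
    (h : ℝ → V → V) (h_one : h 1 = id) (h_mul : ∀ l m : ℝ, h (l * m) = h l ∘ h m)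
    (h_smooth : ContDiff ℝ (⊤ : ℕ∞) (fun p : ℝ × V => h p.1 p.2))
    (h_zero : ∀ x : V, h 0 x = 0)
    (h_reg : ∀ x : V, deriv (fun l : ℝ => h l x) 0 = 0 → x = 0) :
    Function.Bijective (fun x : V => deriv (fun l : ℝ => h l x) 0) ∧
    ∀ (l : ℝ) (x : V),
      deriv (fun m : ℝ => h m (h l x)) 0 = l • deriv (fun m : ℝ => h m x) 0 := by
  set H : ℝ × V → V := fun p => h p.1 p.2 with hH
  have hHd : Differentiable ℝ H := h_smooth.differentiable (by simp)
  have hcurve : ∀ x : V, ∀ s : ℝ, HasDerivAt (fun l : ℝ => h l x) (fderiv ℝ H (s, x) (1, 0)) s := by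
    intro x s
    have h1 : HasDerivAt (fun l : ℝ => ((l, x) : ℝ × V)) (1, 0) s :=
      (hasDerivAt_id s).prodMk (hasDerivAt_const s x)
    exact (hHd (s, x)).hasFDerivAt.comp_hasDerivAt s h1
  set F : V → V := fun x => deriv (fun l : ℝ => h l x) 0 with hF
  have hmul : ∀ l m x, h l (h m x) = h (l * m) x := fun l m x => by rw [h_mul]; rfl
  have hone : ∀ x, h 1 x = x := fun x => by rw [h_one]; rfl
  have hFeq : ∀ x, F x = fderiv ℝ H (0, x) (1, 0) := fun x => (hcurve x 0).deriv
  have hequi : ∀ (l : ℝ) (x : V), F (h l x) = l • F x := by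
    intro l x
    have h0 : HasDerivAt (fun m : ℝ => h m x) (F x) (0 * l) := by
      rw [zero_mul, hFeq]; exact hcurve x 0
    have h1 : HasDerivAt (fun m : ℝ => m * l) l 0 := by
      simpa using (hasDerivAt_id (0 : ℝ)).mul_const l
    have h2 := HasDerivAt.scomp (0 : ℝ) h0 h1
    have h3 : (fun m : ℝ => h m (h l x)) = (fun m : ℝ => h m x) ∘ (fun m : ℝ => m * l) := by
      funext m; exact hmul m l x
    change deriv (fun m : ℝ => h m (h l x)) 0 = _
    rw [h3]; exact h2.deriv
  have hFsm : ContDiff ℝ 1 F := by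
    have h1 : ContDiff ℝ 1 (fderiv ℝ H) :=
      (h_smooth.of_le (m := 2) (WithTop.coe_le_coe.2 (le_top : (2 : ℕ∞) ≤ ⊤))).fderiv_right
        (by norm_num)
    have h2 : ContDiff ℝ 1 (fun x : V => fderiv ℝ H (0, x) (1, 0)) :=
      (h1.comp (contDiff_prodMk_right 0)).clm_apply contDiff_const
    exact (funext hFeq : F = _) ▸ h2
  have hF0 : F 0 = 0 := by
    have := hequi 0 0
    rwa [h_zero, zero_smul] at this
  have hbound : ∃ C : ℝ, 0 < C ∧ ∀ s ∈ Set.Icc (0:ℝ) 1, ∀ y : V, ‖y‖ ≤ 1 → ‖h s y‖ ≤ C * s := by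
    have hK : IsCompact (Set.Icc (0:ℝ) 1 ×ˢ Metric.closedBall (0:V) 1) :=
      isCompact_Icc.prod (isCompact_closedBall 0 1)
    have hc : Continuous (fun p : ℝ × V => fderiv ℝ H p (1, 0)) :=
      (h_smooth.continuous_fderiv (by simp)).clm_apply continuous_const
    obtain ⟨C, hC⟩ := hK.exists_bound_of_continuousOn hc.continuousOn
    refine ⟨max C 1, by positivity, fun s hs y hy => ?_⟩
    have := (convex_Icc (0:ℝ) 1).norm_image_sub_le_of_norm_hasDerivWithin_le
      (f := fun l => h l y) (C := max C 1)
      (fun t ht => (hcurve y t).hasDerivWithinAt)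
      (fun t ht => (hC (t, y) ⟨ht, by simpa using hy⟩).trans (le_max_left _ _))
      (Set.left_mem_Icc.2 zero_le_one) hs
    simpa [h_zero, abs_of_nonneg hs.1] using this
  obtain ⟨C, hC0, hC⟩ := hbound
  have hcont : ∀ x, Continuous (fun l : ℝ => h l x) := fun x =>
    continuous_iff_continuousAt.2 fun s => (hcurve x s).continuousAt
  have hFd : HasFDerivAt F (fderiv ℝ F 0) 0 := (hFsm.differentiable (by simp) 0).hasFDerivAt
  -- injectivity of the derivative
  have hker : ∀ v : V, fderiv ℝ F 0 v = 0 → v = 0 := by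
    intro v hv
    by_contra hv0
    have hvpos : 0 < ‖v‖ := norm_pos_iff.2 hv0
    -- lower bound on the sphere
    have hlow : ∃ c : ℝ, 0 < c ∧ ∀ y : V, ‖y‖ = 1 → c ≤ ‖F y‖ := by
      have hne : (Metric.sphere (0:V) 1).Nonempty :=
        ⟨‖v‖⁻¹ • v, by simp [norm_smul, hvpos.ne']⟩
      obtain ⟨y0, hy0, hmin⟩ := (isCompact_sphere (0:V) 1).exists_isMinOn hne
        (hFsm.continuous.norm.continuousOn)
      refine ⟨‖F y0‖, ?_, fun y hy => hmin (by simpa using hy)⟩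
      refine norm_pos_iff.2 fun h0 => ?_
      have := h_reg y0 h0
      simp [this] at hy0
    obtain ⟨c, hc0, hc⟩ := hlow
    have hesc : ∀ x : V, x ≠ 0 → ‖x‖ < 1 → ∃ t : ℝ, 1 ≤ t ∧ ‖h t x‖ = 1 := by
      intro x hx hx1
      have hxp : 0 < ‖x‖ := norm_pos_iff.2 hx
      set T : ℝ := max 1 ((C + 1) / ‖x‖) with hT
      have hT1 : 1 ≤ T := le_max_left _ _
      have hbig : 1 ≤ ‖h T x‖ := by
        by_contra hlt
        push Not at hlt
        have h1 := hC T⁻¹ ⟨by positivity, inv_le_one_of_one_le₀ hT1⟩ (h T x) hlt.le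
        rw [hmul, inv_mul_cancel₀ (by positivity), hone, ← div_eq_mul_inv,
          le_div_iff₀ (by positivity)] at h1
        have h2 : (C + 1) / ‖x‖ ≤ T := le_max_right _ _
        rw [div_le_iff₀ hxp] at h2
        linarith
      obtain ⟨t, ht, hte⟩ := intermediate_value_Icc hT1 (hcont x).norm.continuousOn
        (show (1:ℝ) ∈ Set.Icc ‖h 1 x‖ ‖h T x‖ from ⟨by rw [hone]; exact hx1.le, hbig⟩)
      exact ⟨t, ht.1, hte⟩
    have hlin : ∀ x : V, x ≠ 0 → ‖x‖ < 1 → c / C * ‖x‖ ≤ ‖F x‖ := by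
      intro x hx hx1
      obtain ⟨t, ht1, hte⟩ := hesc x hx hx1
      have ht0 : 0 < t := by linarith
      have h1 := hC t⁻¹ ⟨by positivity, inv_le_one_of_one_le₀ ht1⟩ (h t x) hte.le
      rw [hmul, inv_mul_cancel₀ ht0.ne', hone, ← div_eq_mul_inv, le_div_iff₀ ht0] at h1
      have h2 := hc _ hte
      rw [hequi, norm_smul, Real.norm_of_nonneg ht0.le] at h2
      have h3 : c * (‖x‖ * t) ≤ (t * ‖F x‖) * C := by
        gcongr
      rw [div_mul_eq_mul_div, div_le_iff₀ hC0]
      nlinarith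
    have hlo := hFd.isLittleO
    have hev := hlo.def (show 0 < c / C / 2 by positivity)
    have htend : Filter.Tendsto (fun e : ℝ => e • v) (nhdsWithin 0 (Set.Ioi 0)) (nhds 0) := by
      have : Continuous (fun e : ℝ => e • v) := by fun_prop
      simpa using (this.tendsto 0).mono_left nhdsWithin_le_nhds
    have hb : ∀ᶠ x : V in nhds 0, ‖x‖ < 1 := by
      filter_upwards [Metric.ball_mem_nhds (0:V) one_pos] with x hx
      simpa using hx
    obtain ⟨e, ⟨he1, he2⟩, he3⟩ :=
      ((htend.eventually (hev.and hb)).and self_mem_nhdsWithin).exists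
    have he3 : 0 < e := he3
    have hx : e • v ≠ 0 := smul_ne_zero he3.ne' hv0
    have h1 := hlin _ hx he2
    simp only [hF0, sub_zero, map_smul, hv, smul_zero] at he1
    have h2 : 0 < c / C * ‖e • v‖ := mul_pos (by positivity) (norm_pos_iff.2 hx)
    linarith
  have hinj : Function.Injective (fderiv ℝ F 0 : V →ₗ[ℝ] V) :=
    (injective_iff_map_eq_zero _).2 hker
  let A : V ≃L[ℝ] V := (LinearEquiv.ofInjectiveEndo _ hinj).toContinuousLinearEquiv
  have hA : (A : V →L[ℝ] V) = fderiv ℝ F 0 := by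
    ext x; rfl
  have hst : HasStrictFDerivAt F (A : V →L[ℝ] V) 0 := by
    rw [hA]; exact hFsm.contDiffAt.hasStrictFDerivAt (by simp)
  have hto0 : ∀ x, Filter.Tendsto (fun s : ℝ => h s x) (nhdsWithin 0 (Set.Ioi 0)) (nhds 0) := by
    intro x
    have := ((hcont x).tendsto 0).mono_left (nhdsWithin_le_nhds (s := Set.Ioi 0))
    rwa [h_zero] at this
  refine ⟨⟨?_, ?_⟩, hequi⟩
  · intro x y hxy
    have hxy : F x = F y := hxy
    obtain ⟨U, hU, hUi⟩ : ∃ U ∈ nhds (0:V), Set.InjOn F U :=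
      ⟨(hst.toOpenPartialHomeomorph F).source,
        (hst.toOpenPartialHomeomorph F).open_source.mem_nhds hst.mem_toOpenPartialHomeomorph_source,
        (hst.toOpenPartialHomeomorph F).injOn⟩
    obtain ⟨s, ⟨h1, h2⟩, h3⟩ :=
      (((hto0 x).eventually hU).and ((hto0 y).eventually hU) |>.and self_mem_nhdsWithin).exists
    have h3 : 0 < s := h3
    have := hUi h1 h2 (by rw [hequi, hequi, hxy])
    have := congrArg (h s⁻¹) this
    rwa [hmul, hmul, inv_mul_cancel₀ h3.ne', hone, hone] at this
  · intro w
    have hmap := hst.map_nhds_eq_of_equiv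
    rw [hF0] at hmap
    have hr : Set.range F ∈ nhds (0:V) := by
      rw [← hmap]; exact Filter.range_mem_map
    have htend : Filter.Tendsto (fun e : ℝ => e • w) (nhdsWithin 0 (Set.Ioi 0)) (nhds 0) := by
      have : Continuous (fun e : ℝ => e • w) := by fun_prop
      simpa using (this.tendsto 0).mono_left nhdsWithin_le_nhds
    obtain ⟨e, ⟨x, hx⟩, he⟩ := ((htend.eventually hr).and self_mem_nhdsWithin).exists
    have he : 0 < e := he
    refine ⟨h e⁻¹ x, ?_⟩
    change F (h e⁻¹ x) = w
    rw [hequi, hx]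
    exact inv_smul_smul₀ he.ne' w
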